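/- arXiv:2102.06255 — 2 statements merged into one kernel-verified Lean document; each statement's English description precedes it below -/
import Mathlib

section
/- Let n ≥ 1 and k ≥ 1, and let S^{k,k} denote the complex vector space of polynomials in ℂ[z_0,…,z_n,w_0,…,w_n] homogeneous of degree k in z_0,…,z_n and of degree k in w_0,…,w_n. Then the kernel of the operator □ = ∑_{i=0}^{n} ∂²/∂z_i∂w_i restricted to S^{k,k} is exactly the complex linear span of the polynomials (a·z)^k (b·w)^k over all a, b ∈ ℂ^{n+1} with a·b = 0, where a·z = ∑_i a_i z_i and a·b = ∑_i a_i b_i. -/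
open MvPolynomial Finset

/-- The space `S^{p,q}` of bihomogeneous polynomials of bidegree `(p,q)` in
`ℂ[z_0,…,z_n,w_0,…,w_n]` (variables indexed by `Fin (n+1) ⊕ Fin (n+1)`). -/
noncomputable def biHomSubmodule (n p q : ℕ) :
    Submodule ℂ (MvPolynomial (Fin (n + 1) ⊕ Fin (n + 1)) ℂ) :=
  weightedHomogeneousSubmodule ℂ
    (Sum.elim (fun _ => ((1 : ℕ), (0 : ℕ))) (fun _ => ((0 : ℕ), (1 : ℕ)))) (p, q)

/-- The operator `□ = ∑_i ∂²/∂z_i∂w_i` as a linear map. -/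
noncomputable def boxOp (n : ℕ) :
    MvPolynomial (Fin (n + 1) ⊕ Fin (n + 1)) ℂ →ₗ[ℂ]
      MvPolynomial (Fin (n + 1) ⊕ Fin (n + 1)) ℂ :=
  ∑ i : Fin (n + 1),
    ((pderiv (Sum.inl i)).toLinearMap.comp (pderiv (Sum.inr i)).toLinearMap)

section Apolar

variable {σ R : Type*} [Fintype σ] [CommSemiring R]

/-- The apolar (Fischer) pairing `⟨f, h⟩ = (f(∂) h)(0)`, for which distinct monomials are orthogonal
and `⟨X^m, X^m⟩ = m!`. -/
noncomputable def apolarPairing : MvPolynomial σ R →ₗ[R] MvPolynomial σ R →ₗ[R] R :=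
  (basisMonomials σ R).constr R fun m => ((∏ i, (m i).factorial : ℕ) : R) • lcoeff R m

theorem apolarPairing_monomial (m : σ →₀ ℕ) (c : R) (h : MvPolynomial σ R) :
    apolarPairing (monomial m c) h = c * ((∏ i, (m i).factorial : ℕ) * coeff m h) := by
  have h1 : (monomial m c : MvPolynomial σ R) = c • basisMonomials σ R m := by
    simp [smul_monomial]
  rw [h1, map_smul, apolarPairing, Module.Basis.constr_basis]
  simp

/-- Multiplication by a variable is adjoint to differentiation. -/
theorem apolarPairing_mul_X (f h : MvPolynomial σ R) (i : σ) :
    apolarPairing (f * X i) h = apolarPairing f (pderiv i h) := by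
  classical
  induction f using MvPolynomial.induction_on' with
  | monomial m c =>
    have hfac : (∏ j, ((m + Finsupp.single i 1 : σ →₀ ℕ) j).factorial) =
        (∏ j, (m j).factorial) * (m i + 1) := by
      rw [← Finset.mul_prod_erase univ _ (mem_univ i),
        ← Finset.mul_prod_erase univ (fun j => (m j).factorial) (mem_univ i)]
      have : ∀ j ∈ univ.erase i, ((m + Finsupp.single i 1 : σ →₀ ℕ) j).factorial = (m j).factorial := by
        intro j hj
        simp [Finsupp.single_eq_of_ne (ne_of_mem_erase hj)]
      rw [prod_congr rfl this]
      simp [Nat.factorial_succ]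
      ring
    rw [X, monomial_mul, apolarPairing_monomial, apolarPairing_monomial, coeff_pderiv, hfac]
    push_cast
    ring
  | add p q hp hq => simp only [add_mul, map_add, LinearMap.add_apply, hp, hq]

end Apolar

section Bihomogeneous

variable {n : ℕ}

theorem weight_bidegree (m : Fin (n + 1) ⊕ Fin (n + 1) →₀ ℕ) :
    Finsupp.weight (Sum.elim (fun _ => ((1 : ℕ), (0 : ℕ))) (fun _ => ((0 : ℕ), (1 : ℕ)))) m =
      (∑ j, m (Sum.inl j), ∑ j, m (Sum.inr j)) := by
  rw [Finsupp.weight_eq_sum, Fintype.sum_sum_type]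
  ext <;> simp [Prod.fst_sum, Prod.snd_sum]

theorem mem_biHomSubmodule {p q : ℕ} {f : MvPolynomial (Fin (n + 1) ⊕ Fin (n + 1)) ℂ} :
    f ∈ biHomSubmodule n p q ↔
      ∀ m, coeff m f ≠ 0 → ∑ j, m (Sum.inl j) = p ∧ ∑ j, m (Sum.inr j) = q := by
  simp only [biHomSubmodule, mem_weightedHomogeneousSubmodule, IsWeightedHomogeneous,
    weight_bidegree, Prod.mk.injEq]

theorem finite_setOf_bidegree (n p q : ℕ) :
    {m : Fin (n + 1) ⊕ Fin (n + 1) →₀ ℕ |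
      ∑ j, m (Sum.inl j) = p ∧ ∑ j, m (Sum.inr j) = q}.Finite := by
  refine (Finsupp.finite_of_nat_weight_eq (fun _ => 1) (fun _ => one_ne_zero) (p + q)).subset ?_
  rintro m ⟨h1, h2⟩
  simp [Finsupp.weight_eq_sum, h1, h2]

/-- The product `(a·z)^p (b·w)^q`. -/
noncomputable def linearPowMul (a b : Fin (n + 1) → ℂ) (p q : ℕ) :
    MvPolynomial (Fin (n + 1) ⊕ Fin (n + 1)) ℂ :=
  (∑ j, C (a j) * X (Sum.inl j)) ^ p * (∑ j, C (b j) * X (Sum.inr j)) ^ q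

theorem linearPowMul_mem (a b : Fin (n + 1) → ℂ) (p q : ℕ) :
    linearPowMul a b p q ∈ biHomSubmodule n p q := by
  have hl : IsWeightedHomogeneous
      (Sum.elim (fun _ => ((1 : ℕ), (0 : ℕ))) (fun _ => ((0 : ℕ), (1 : ℕ))))
      (∑ j, C (a j) * X (Sum.inl j) : MvPolynomial (Fin (n + 1) ⊕ Fin (n + 1)) ℂ) (1, 0) := by
    refine IsWeightedHomogeneous.sum _ _ _ fun j _ => ?_
    rw [← zero_add ((1, 0) : ℕ × ℕ)]
    exact (isWeightedHomogeneous_C _ (a j)).mul (isWeightedHomogeneous_X ℂ _ (Sum.inl j))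
  have hr : IsWeightedHomogeneous
      (Sum.elim (fun _ => ((1 : ℕ), (0 : ℕ))) (fun _ => ((0 : ℕ), (1 : ℕ))))
      (∑ j, C (b j) * X (Sum.inr j) : MvPolynomial (Fin (n + 1) ⊕ Fin (n + 1)) ℂ) (0, 1) := by
    refine IsWeightedHomogeneous.sum _ _ _ fun j _ => ?_
    rw [← zero_add ((0, 1) : ℕ × ℕ)]
    exact (isWeightedHomogeneous_C _ (b j)).mul (isWeightedHomogeneous_X ℂ _ (Sum.inr j))
  simpa [biHomSubmodule, linearPowMul] using (hl.pow p).mul (hr.pow q)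

theorem pderiv_inl_linearPowMul (a b : Fin (n + 1) → ℂ) (p q : ℕ) (i : Fin (n + 1)) :
    pderiv (Sum.inl i) (linearPowMul a b p q) =
      (p * a i : ℂ) • linearPowMul a b (p - 1) q := by
  have h1 : pderiv (Sum.inl i) (∑ j, C (a j) * X (Sum.inl j) :
      MvPolynomial (Fin (n + 1) ⊕ Fin (n + 1)) ℂ) = C (a i) := by
    simp [Pi.single_apply]
  have h2 : pderiv (Sum.inl i) (∑ j, C (b j) * X (Sum.inr j) :
      MvPolynomial (Fin (n + 1) ⊕ Fin (n + 1)) ℂ) = 0 := by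
    simp
  simp only [linearPowMul, pderiv_mul, pderiv_pow, h1, h2, smul_eq_C_mul, map_mul, map_natCast]
  ring

theorem pderiv_inr_linearPowMul (a b : Fin (n + 1) → ℂ) (p q : ℕ) (i : Fin (n + 1)) :
    pderiv (Sum.inr i) (linearPowMul a b p q) =
      (q * b i : ℂ) • linearPowMul a b p (q - 1) := by
  have h1 : pderiv (Sum.inr i) (∑ j, C (b j) * X (Sum.inr j) :
      MvPolynomial (Fin (n + 1) ⊕ Fin (n + 1)) ℂ) = C (b i) := by
    simp [Pi.single_apply]
  have h2 : pderiv (Sum.inr i) (∑ j, C (a j) * X (Sum.inl j) :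
      MvPolynomial (Fin (n + 1) ⊕ Fin (n + 1)) ℂ) = 0 := by
    simp
  simp only [linearPowMul, pderiv_mul, pderiv_pow, h1, h2, smul_eq_C_mul, map_mul, map_natCast]
  ring

theorem boxOp_apply (f : MvPolynomial (Fin (n + 1) ⊕ Fin (n + 1)) ℂ) :
    boxOp n f = ∑ i, pderiv (Sum.inl i) (pderiv (Sum.inr i) f) := by
  simp [boxOp]

theorem boxOp_linearPowMul (a b : Fin (n + 1) → ℂ) (p q : ℕ) :
    boxOp n (linearPowMul a b p q) =
      (p * q * ∑ i, a i * b i : ℂ) • linearPowMul a b (p - 1) (q - 1) := by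
  simp only [boxOp_apply, pderiv_inr_linearPowMul, Derivation.map_smul, pderiv_inl_linearPowMul,
    smul_smul, ← Finset.sum_smul, Finset.mul_sum]
  congr 1
  exact Finset.sum_congr rfl fun i _ => by ring

/-- The apolar pairing of a monomial with `(a·z)^p (b·w)^q`, where `(p, q)` is its bidegree. -/
theorem apolarPairing_monomial_linearPowMul (a b : Fin (n + 1) → ℂ)
    (m : Fin (n + 1) ⊕ Fin (n + 1) →₀ ℕ) (c : ℂ) :
    apolarPairing (monomial m c)
        (linearPowMul a b (∑ j, m (Sum.inl j)) (∑ j, m (Sum.inr j))) =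
      (∑ j, m (Sum.inl j)).factorial * (∑ j, m (Sum.inr j)).factorial *
        eval (Sum.elim a b) (monomial m c) := by
  classical
  induction hd : m.degree generalizing m with
  | zero =>
    obtain rfl : m = 0 := (Finsupp.degree_eq_zero_iff m).mp hd
    rw [apolarPairing_monomial]
    simp [linearPowMul]
  | succ d ih =>
    obtain ⟨i, hi⟩ : ∃ i, m i ≠ 0 := by
      by_contra! h0
      obtain rfl : m = 0 := Finsupp.ext h0
      simp at hd
    obtain ⟨m, rfl⟩ : ∃ m', m = m' + Finsupp.single i 1 :=
      ⟨_, (Finsupp.sub_add_single_one_cancel hi).symm⟩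
    have hm := ih m (by simpa using hd)
    have hX : (monomial (m + Finsupp.single i 1) c :
        MvPolynomial (Fin (n + 1) ⊕ Fin (n + 1)) ℂ) = monomial m c * X i := by
      rw [X, monomial_mul, mul_one]
    rw [hX, apolarPairing_mul_X, map_mul, eval_X]
    rcases i with i | i
    · have hl : ∑ j, (m + Finsupp.single (Sum.inl i) 1 : _ →₀ ℕ) (Sum.inl j) =
          ∑ j, m (Sum.inl j) + 1 := by
        simp [Finset.sum_add_distrib, Finsupp.single_apply]
      have hr : ∑ j, (m + Finsupp.single (Sum.inl i) 1 : _ →₀ ℕ) (Sum.inr j) =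
          ∑ j, m (Sum.inr j) := by
        simp
      rw [hl, hr, pderiv_inl_linearPowMul, map_smul, Nat.add_sub_cancel, hm, Nat.factorial_succ,
        Sum.elim_inl, smul_eq_mul]
      push_cast
      ring
    · have hl : ∑ j, (m + Finsupp.single (Sum.inr i) 1 : _ →₀ ℕ) (Sum.inl j) =
          ∑ j, m (Sum.inl j) := by
        simp
      have hr : ∑ j, (m + Finsupp.single (Sum.inr i) 1 : _ →₀ ℕ) (Sum.inr j) =
          ∑ j, m (Sum.inr j) + 1 := by
        simp [Finset.sum_add_distrib, Finsupp.single_apply]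
      rw [hl, hr, pderiv_inr_linearPowMul, map_smul, Nat.add_sub_cancel, hm, Nat.factorial_succ,
        Sum.elim_inr, smul_eq_mul]
      push_cast
      ring

/-- The apolar pairing against `(a·z)^p (b·w)^q` is evaluation at `(a, b)` up to a scalar. -/
theorem apolarPairing_linearPowMul (a b : Fin (n + 1) → ℂ) {p q : ℕ}
    {f : MvPolynomial (Fin (n + 1) ⊕ Fin (n + 1)) ℂ} (hf : f ∈ biHomSubmodule n p q) :
    apolarPairing f (linearPowMul a b p q) =
      p.factorial * q.factorial * eval (Sum.elim a b) f := by
  rw [mem_biHomSubmodule] at hf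
  conv_lhs => rw [f.as_sum]
  conv_rhs => rw [f.as_sum]
  rw [map_sum, LinearMap.sum_apply, map_sum, Finset.mul_sum]
  refine Finset.sum_congr rfl fun m hm => ?_
  obtain ⟨rfl, rfl⟩ := hf m (mem_support_iff.mp hm)
  exact apolarPairing_monomial_linearPowMul a b m _

/-- Every linear functional is represented, on bihomogeneous polynomials, by the apolar pairing
with a bihomogeneous polynomial. -/
theorem exists_apolarPairing_eq (p q : ℕ)
    (φ : MvPolynomial (Fin (n + 1) ⊕ Fin (n + 1)) ℂ →ₗ[ℂ] ℂ) :
    ∃ f ∈ biHomSubmodule n p q, ∀ h ∈ biHomSubmodule n p q, apolarPairing f h = φ h := by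
  classical
  set s := (finite_setOf_bidegree n p q).toFinset with hs
  refine ⟨∑ m ∈ s, monomial m (φ (monomial m 1) / ((∏ i, (m i).factorial : ℕ) : ℂ)),
    Submodule.sum_mem _ fun m hm => ?_, fun h hh => ?_⟩
  · rw [mem_biHomSubmodule]
    intro d hd
    rw [coeff_monomial] at hd
    obtain rfl : m = d := by
      by_contra hne
      exact hd (if_neg hne)
    simpa [hs] using hm
  · rw [mem_biHomSubmodule] at hh
    have hsub : h.support ⊆ s := fun m hm => by
      simpa [hs] using hh m (mem_support_iff.mp hm)
    have hsum : h = ∑ m ∈ s, coeff m h • monomial m (1 : ℂ) := by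
      conv_lhs => rw [h.as_sum]
      rw [Finset.sum_subset hsub fun m _ hm => by simp [notMem_support_iff.mp hm]]
      simp [smul_monomial]
    conv_rhs => rw [hsum]
    simp only [map_sum, LinearMap.sum_apply, map_smul, apolarPairing_monomial, smul_eq_mul]
    refine Finset.sum_congr rfl fun m _ => ?_
    have hne : ((∏ i, (m i).factorial : ℕ) : ℂ) ≠ 0 :=
      Nat.cast_ne_zero.mpr (Finset.prod_ne_zero_iff.mpr fun i _ => Nat.factorial_ne_zero _)
    field_simp

/-- A polynomial vanishing on the quadric `z·w = 0` is a multiple of `z·w`. -/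
theorem dvd_of_eval_eq_zero (hn : 1 ≤ n) (f : MvPolynomial (Fin (n + 1) ⊕ Fin (n + 1)) ℂ)
    (hf : ∀ a b : Fin (n + 1) → ℂ, ∑ i, a i * b i = 0 → eval (Sum.elim a b) f = 0) :
    (∑ i, X (Sum.inl i) * X (Sum.inr i)) ∣ f := by
  have hirr : Irreducible (∑ i, X (Sum.inl i) * X (Sum.inr i) :
      MvPolynomial (Fin (n + 1) ⊕ Fin (n + 1)) ℂ) := by
    have : Nontrivial (Fin (n + 1)) := Fin.nontrivial_iff_two_le.mpr (by lia)
    have hc := irreducible_sumSMulXSMulY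
      (Finsupp.equivFunOnFinite.symm fun _ : Fin (n + 1) => (1 : ℂ))
      (by simpa [Set.Nontrivial, Finset.Nontrivial, Function.support] using exists_pair_ne _)
      (fun r hr => isUnit_of_dvd_one (by simpa using hr 0))
    simpa [sumSMulXSMulY, Finsupp.linearCombination_apply, Finsupp.sum_fintype] using hc
  have : (Ideal.span {(∑ i, X (Sum.inl i) * X (Sum.inr i) :
      MvPolynomial (Fin (n + 1) ⊕ Fin (n + 1)) ℂ)}).IsPrime :=
    (Ideal.span_singleton_prime hirr.ne_zero).mpr hirr.prime
  rw [← Ideal.mem_span_singleton, ← IsPrime.vanishingIdeal_zeroLocus (K := ℂ) (Ideal.span _), mem_vanishingIdeal_iff]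
  intro x hx
  have h0 := hx _ (Ideal.mem_span_singleton_self _)
  simp only [map_sum, map_mul, aeval_X] at h0
  have := hf (x ∘ Sum.inl) (x ∘ Sum.inr) h0
  rwa [Sum.elim_comp_inl_inr] at this

/-- Multiplication by `z·w` is adjoint to `□`. -/
theorem apolarPairing_mul_dot (f h : MvPolynomial (Fin (n + 1) ⊕ Fin (n + 1)) ℂ) :
    apolarPairing ((∑ i, X (Sum.inl i) * X (Sum.inr i)) * f) h = apolarPairing f (boxOp n h) := by
  rw [mul_comm, Finset.mul_sum, map_sum, LinearMap.sum_apply, boxOp_apply, map_sum]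
  refine Finset.sum_congr rfl fun i _ => ?_
  rw [← mul_assoc, apolarPairing_mul_X, apolarPairing_mul_X]

end Bihomogeneous

/-- the kernel of `□` on `S^{k,k}` is exactly the span of the
polynomials `(a·z)^k (b·w)^k` over all `a, b ∈ ℂ^{n+1}` with `a·b = 0`. -/
theorem stmt_6 (n k : ℕ) (hn : 1 ≤ n) (hk : 1 ≤ k) :
    biHomSubmodule n k k ⊓ LinearMap.ker (boxOp n) =
      Submodule.span ℂ
        {P : MvPolynomial (Fin (n + 1) ⊕ Fin (n + 1)) ℂ |
          ∃ a b : Fin (n + 1) → ℂ, (∑ i, a i * b i) = 0 ∧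
            P = (∑ j, C (a j) * X (Sum.inl j)) ^ k *
                (∑ j, C (b j) * X (Sum.inr j)) ^ k} := by
  apply le_antisymm
  · rintro h ⟨hh, hbox⟩
    by_contra hspan
    obtain ⟨φ, hφh, hφ⟩ := Submodule.exists_le_ker_of_notMem hspan
    obtain ⟨f, hf, hfφ⟩ := exists_apolarPairing_eq k k φ
    obtain ⟨g, rfl⟩ : (∑ i, X (Sum.inl i) * X (Sum.inr i)) ∣ f := by
      refine dvd_of_eval_eq_zero hn f fun a b hab => ?_
      have h0 : φ (linearPowMul a b k k) = 0 := hφ (Submodule.subset_span ⟨a, b, hab, rfl⟩)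
      rw [← hfφ _ (linearPowMul_mem a b k k), apolarPairing_linearPowMul a b hf] at h0
      simpa [Nat.factorial_ne_zero] using h0
    apply hφh
    rw [← hfφ h hh, apolarPairing_mul_dot, LinearMap.mem_ker.mp hbox, map_zero]
  · rw [Submodule.span_le]
    rintro _ ⟨a, b, hab, rfl⟩
    refine ⟨linearPowMul_mem a b k k, ?_⟩
    have := boxOp_linearPowMul a b k k
    rw [hab, mul_zero, zero_smul] at this
    exact this
end

section
/- Let n ≥ 0 and let A, B ∈ ℂ^{2n+2}. In the polynomial ring ℂ[U_0,…,U_{2n+1},V_0,…,V_{2n+1}] define l_{AB} = (A·U)(B·V) − (B·U)(A·V), the operator □ = ∑_{i=0}^{n} ( ∂²/∂U_i∂V_{n+1+i} − ∂²/∂V_i∂U_{n+1+i} ), and the scalar I(A,B) = ∑_{i=0}^{n} (A_i B_{n+1+i} − A_{n+1+i} B_i). Then for every integer k ≥ 1, □(l_{AB}^k) = k(k+1)·I(A,B)·l_{AB}^{k−1}. In particular, if I(A,B) = 0 then l_{AB}^k lies in the kernel of □. -/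
open MvPolynomial Finset

namespace MvPolynomial

section LinearForms

variable {σ R : Type*} [Fintype σ] [CommRing R]

/-- The derivative of a linear form in the left variables along a left variable. -/
theorem pderiv_inl_sum_C_mul_X_inl (a : σ → R) (i : σ) :
    pderiv (Sum.inl i) (∑ j, C (a j) * X (Sum.inl j) : MvPolynomial (σ ⊕ σ) R) = C (a i) := by
  classical
  simp [pderiv_X, Pi.single_apply]

/-- The derivative of a linear form in the right variables along a right variable. -/
theorem pderiv_inr_sum_C_mul_X_inr (a : σ → R) (i : σ) :
    pderiv (Sum.inr i) (∑ j, C (a j) * X (Sum.inr j) : MvPolynomial (σ ⊕ σ) R) = C (a i) := by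
  classical
  simp [pderiv_X, Pi.single_apply]

/-- A linear form in the right variables does not depend on the left variables. -/
theorem pderiv_inl_sum_C_mul_X_inr (a : σ → R) (i : σ) :
    pderiv (Sum.inl i) (∑ j, C (a j) * X (Sum.inr j) : MvPolynomial (σ ⊕ σ) R) = 0 := by
  classical
  simp [pderiv_X]

/-- A linear form in the left variables does not depend on the right variables. -/
theorem pderiv_inr_sum_C_mul_X_inl (a : σ → R) (i : σ) :
    pderiv (Sum.inr i) (∑ j, C (a j) * X (Sum.inl j) : MvPolynomial (σ ⊕ σ) R) = 0 := by
  classical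
  simp [pderiv_X]

/-- The polarized Cayley identity for the `2 × 2` determinant `l` of two linear forms evaluated
on two vectors of variables. -/
theorem pderiv_pderiv_sub_det_pow (a b : σ → R) (i j : σ) (m : ℕ)
    (l : MvPolynomial (σ ⊕ σ) R)
    (hl : l = (∑ j, C (a j) * X (Sum.inl j)) * (∑ j, C (b j) * X (Sum.inr j)) -
      (∑ j, C (b j) * X (Sum.inl j)) * (∑ j, C (a j) * X (Sum.inr j))) :
    pderiv (Sum.inl i) (pderiv (Sum.inr j) (l ^ (m + 1))) -
      pderiv (Sum.inr i) (pderiv (Sum.inl j) (l ^ (m + 1))) =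
    C (((m : R) + 1) * ((m : R) + 2) * (a i * b j - a j * b i)) * l ^ m := by
  have haU := pderiv_inl_sum_C_mul_X_inl a
  have hbU := pderiv_inl_sum_C_mul_X_inl b
  have haV := pderiv_inr_sum_C_mul_X_inr a
  have hbV := pderiv_inr_sum_C_mul_X_inr b
  have haU' := pderiv_inr_sum_C_mul_X_inl a
  have hbU' := pderiv_inr_sum_C_mul_X_inl b
  have haV' := pderiv_inl_sum_C_mul_X_inr a
  have hbV' := pderiv_inl_sum_C_mul_X_inr b
  generalize (∑ j, C (a j) * X (Sum.inl j) : MvPolynomial (σ ⊕ σ) R) = p at *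
  generalize (∑ j, C (b j) * X (Sum.inl j) : MvPolynomial (σ ⊕ σ) R) = q at *
  generalize (∑ j, C (a j) * X (Sum.inr j) : MvPolynomial (σ ⊕ σ) R) = r at *
  generalize (∑ j, C (b j) * X (Sum.inr j) : MvPolynomial (σ ⊕ σ) R) = s at *
  have hU (t : σ) : pderiv (Sum.inl t) l = C (a t) * s - C (b t) * r := by
    simp only [hl, map_sub, pderiv_mul, haU, hbU, haV', hbV']
    ring
  have hV (t : σ) : pderiv (Sum.inr t) l = p * C (b t) - q * C (a t) := by
    simp only [hl, map_sub, pderiv_mul, haV, hbV, haU', hbU']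
    ring
  have hnat (t : σ ⊕ σ) : pderiv t ((m + 1 : ℕ) : MvPolynomial (σ ⊕ σ) R) = 0 :=
    Derivation.map_natCast _ _
  simp only [pderiv_pow, pderiv_mul, hnat, hU, hV, map_sub, pderiv_C, haU, hbU, haV, hbV,
    Nat.add_sub_cancel, map_mul, map_add, map_natCast, map_one, map_ofNat]
  cases m with
  | zero =>
    push_cast
    ring
  | succ m =>
    simp only [Nat.add_sub_cancel, pow_succ l m]
    push_cast
    rw [hl]
    ring

end LinearForms

end MvPolynomial

/-- In `ℂ[U, V]` (variables indexed by `Fin (2n+2) ⊕ Fin (2n+2)`,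
`inl` for `U`, `inr` for `V`), let `l_{AB} = (A·U)(B·V) - (B·U)(A·V)`,
`□ = ∑_{i=0}^n (∂²/∂U_i∂V_{n+1+i} - ∂²/∂V_i∂U_{n+1+i})` and
`I(A,B) = ∑_{i=0}^n (A_i B_{n+1+i} - A_{n+1+i} B_i)`. Then for `k ≥ 1`,
`□(l_{AB}^k) = k(k+1) I(A,B) l_{AB}^{k-1}`; in particular `I(A,B) = 0` implies
`l_{AB}^k ∈ ker □`. -/
theorem stmt_7 (n : ℕ) (A B : Fin (2 * n + 2) → ℂ) (k : ℕ) (hk : 1 ≤ k)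
    (lAB : MvPolynomial (Fin (2 * n + 2) ⊕ Fin (2 * n + 2)) ℂ)
    (hlAB : lAB =
      (∑ j, C (A j) * X (Sum.inl j)) * (∑ j, C (B j) * X (Sum.inr j)) -
      (∑ j, C (B j) * X (Sum.inl j)) * (∑ j, C (A j) * X (Sum.inr j)))
    (box : MvPolynomial (Fin (2 * n + 2) ⊕ Fin (2 * n + 2)) ℂ →
      MvPolynomial (Fin (2 * n + 2) ⊕ Fin (2 * n + 2)) ℂ)
    (hbox : ∀ P, box P = ∑ i : Fin (n + 1),
      (pderiv (Sum.inl (⟨i.1, by omega⟩ : Fin (2 * n + 2)))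
         (pderiv (Sum.inr (⟨n + 1 + i.1, by omega⟩ : Fin (2 * n + 2))) P) -
       pderiv (Sum.inr (⟨i.1, by omega⟩ : Fin (2 * n + 2)))
         (pderiv (Sum.inl (⟨n + 1 + i.1, by omega⟩ : Fin (2 * n + 2))) P)))
    (IAB : ℂ)
    (hIAB : IAB = ∑ i : Fin (n + 1),
      (A ⟨i.1, by omega⟩ * B ⟨n + 1 + i.1, by omega⟩ -
       A ⟨n + 1 + i.1, by omega⟩ * B ⟨i.1, by omega⟩)) :
    box (lAB ^ k) = C ((k : ℂ) * ((k : ℂ) + 1) * IAB) * lAB ^ (k - 1) ∧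
    (IAB = 0 → box (lAB ^ k) = 0) := by
  obtain ⟨m, rfl⟩ := Nat.exists_eq_add_of_le' hk
  have key : box (lAB ^ (m + 1)) =
      C (((m + 1 : ℕ) : ℂ) * (((m + 1 : ℕ) : ℂ) + 1) * IAB) * lAB ^ (m + 1 - 1) := by
    simp only [hbox, pderiv_pderiv_sub_det_pow A B _ _ m lAB hlAB, ← Finset.sum_mul, ← map_sum,
      ← Finset.mul_sum, hIAB, Nat.add_sub_cancel]
    congr 2
    push_cast
    ring
  exact ⟨key, fun h => by simp [key, h]⟩
end
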